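/- arXiv:1712.07303 — 3 statements merged into one kernel-verified Lean document; each statement's English description precedes it below -/
import Mathlib

section
/- Let F be a field of characteristic ≠ 2 and let A be a finitely generated associative F-algebra that is nil (every element of A is nilpotent). Then for every i ≥ 1, the Lie derived power A^{[i]} is a finitely generated Lie algebra. -/
/-- `nuPow a n = a ^ (n + 1)` in a non-unital ring. -/
def nuPow {A : Type*} [NonUnitalRing A] (a : A) : ℕ → A
  | 0 => a
  | n + 1 => a * nuPow a n

/-- The linear span of all commutators `u * v - v * u` with `u ∈ U`, `v ∈ V`. -/
def commSpan (F : Type*) [Field F] {A : Type*} [NonUnitalRing A] [Module F A]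
    [SMulCommClass F A A] [IsScalarTower F A A] (U V : Submodule F A) : Submodule F A :=
  Submodule.span F {x | ∃ u ∈ U, ∃ v ∈ V, x = u * v - v * u}

/-- The Lie derived powers `A^{[0]} = A`, `A^{[i+1]} = [A^{[i]}, A^{[i]}]`. -/
def derivedPower (F : Type*) [Field F] (A : Type*) [NonUnitalRing A] [Module F A]
    [SMulCommClass F A A] [IsScalarTower F A A] : ℕ → Submodule F A
  | 0 => ⊤
  | i + 1 => commSpan F (derivedPower F A i) (derivedPower F A i)

/-- The associative (non-unital) subalgebra generated by `S`: the smallest subspace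
containing `S` that is closed under multiplication. -/
def algClosure (F : Type*) [Field F] {A : Type*} [NonUnitalRing A] [Module F A]
    [SMulCommClass F A A] [IsScalarTower F A A] (S : Set A) : Submodule F A :=
  sInf {p : Submodule F A | S ⊆ ↑p ∧ ∀ x ∈ p, ∀ y ∈ p, x * y ∈ p}

/-- The Lie subalgebra of `A⁽⁻⁾` generated by `S`: the smallest subspace containing `S`
that is closed under the commutator bracket. -/
def lieClosure (F : Type*) [Field F] {A : Type*} [NonUnitalRing A] [Module F A]
    [SMulCommClass F A A] [IsScalarTower F A A] (S : Set A) : Submodule F A :=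
  sInf {p : Submodule F A | S ⊆ ↑p ∧ ∀ x ∈ p, ∀ y ∈ p, x * y - y * x ∈ p}

open Submodule

section CommSpan

variable {F : Type*} [Field F] {A : Type*} [NonUnitalRing A] [Module F A]
  [SMulCommClass F A A] [IsScalarTower F A A]

theorem mul_sub_mul_mem_commSpan {U V : Submodule F A} {u v : A} (hu : u ∈ U) (hv : v ∈ V) :
    u * v - v * u ∈ commSpan F U V :=
  subset_span ⟨u, hu, v, hv, rfl⟩

theorem commSpan_le {U V W : Submodule F A} :
    commSpan F U V ≤ W ↔ ∀ u ∈ U, ∀ v ∈ V, u * v - v * u ∈ W := by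
  refine ⟨fun h u hu v hv => h (mul_sub_mul_mem_commSpan hu hv), fun h => span_le.2 ?_⟩
  rintro _ ⟨u, hu, v, hv, rfl⟩
  exact h u hu v hv

theorem commSpan_mono {U U' V V' : Submodule F A} (hU : U ≤ U') (hV : V ≤ V') :
    commSpan F U V ≤ commSpan F U' V' :=
  commSpan_le.2 fun _ hu _ hv => mul_sub_mul_mem_commSpan (hU hu) (hV hv)

theorem mul_sub_mul_mem_of_mem_span {X Y : Set A} {W : Submodule F A}
    (h : ∀ x ∈ X, ∀ y ∈ Y, x * y - y * x ∈ W) {u v : A} (hu : u ∈ span F X)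
    (hv : v ∈ span F Y) : u * v - v * u ∈ W := by
  induction hu, hv using span_induction₂ with
  | mem_mem x y hx hy => exact h x hx y hy
  | zero_left => simp
  | zero_right => simp
  | add_left x y z _ _ _ h₁ h₂ =>
    rw [show (x + y) * z - z * (x + y) = (x * z - z * x) + (y * z - z * y) by
      rw [add_mul, mul_add]; abel]
    exact add_mem h₁ h₂
  | add_right x y z _ _ _ h₁ h₂ =>
    rw [show x * (y + z) - (y + z) * x = (x * y - y * x) + (x * z - z * x) by
      rw [add_mul, mul_add]; abel]
    exact add_mem h₁ h₂
  | smul_left r x y _ _ h =>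
    rw [smul_mul_assoc, mul_smul_comm, ← smul_sub]
    exact W.smul_mem r h
  | smul_right r x y _ _ h =>
    rw [smul_mul_assoc, mul_smul_comm, ← smul_sub]
    exact W.smul_mem r h

theorem commSpan_span_le {X Y : Set A} {W : Submodule F A}
    (h : ∀ x ∈ X, ∀ y ∈ Y, x * y - y * x ∈ W) :
    commSpan F (span F X) (span F Y) ≤ W :=
  commSpan_le.2 fun _ hu _ hv => mul_sub_mul_mem_of_mem_span h hu hv

theorem derivedPower_isLieIdeal (i : ℕ) :
    ∀ u ∈ derivedPower F A i, ∀ a : A, u * a - a * u ∈ derivedPower F A i := by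
  induction i with
  | zero => intro _ _ _; trivial
  | succ i ih =>
    intro x hx a
    rw [derivedPower, commSpan] at hx
    induction hx using span_induction with
    | mem x hx =>
      obtain ⟨u, hu, v, hv, rfl⟩ := hx
      rw [show (u * v - v * u) * a - a * (u * v - v * u) =
        ((u * a - a * u) * v - v * (u * a - a * u)) +
          (u * (v * a - a * v) - (v * a - a * v) * u) by
        simp only [sub_mul, mul_sub, mul_assoc]; abel]
      exact add_mem (mul_sub_mul_mem_commSpan (ih u hu a) hv)
        (mul_sub_mul_mem_commSpan hu (ih v hv a))
    | zero => simp
    | add x y _ _ h₁ h₂ =>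
      rw [show (x + y) * a - a * (x + y) = (x * a - a * x) + (y * a - a * y) by
        rw [add_mul, mul_add]; abel]
      exact add_mem h₁ h₂
    | smul r x _ h =>
      rw [smul_mul_assoc, mul_smul_comm, ← smul_sub]
      exact Submodule.smul_mem _ r h

theorem derivedPower_mul_sub_mul_mem {i : ℕ} {u v : A} (hu : u ∈ derivedPower F A i)
    (_hv : v ∈ derivedPower F A i) : u * v - v * u ∈ derivedPower F A i :=
  derivedPower_isLieIdeal i u hu v

theorem lieClosure_mul_sub_mul_mem {S : Set A} {u v : A} (hu : u ∈ lieClosure F S)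
    (hv : v ∈ lieClosure F S) : u * v - v * u ∈ lieClosure F S := by
  rw [lieClosure, mem_sInf] at *
  exact fun p hp => hp.2 u (hu p hp) v (hv p hp)

theorem subset_lieClosure (S : Set A) : S ⊆ lieClosure F S := by
  intro x hx
  rw [SetLike.mem_coe, lieClosure, mem_sInf]
  exact fun p hp => hp.1 hx

theorem lieClosure_le {S : Set A} {p : Submodule F A} (hS : S ⊆ p)
    (hp : ∀ x ∈ p, ∀ y ∈ p, x * y - y * x ∈ p) : lieClosure F S ≤ p :=
  sInf_le ⟨hS, hp⟩

end CommSpan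

section TwoSided

variable {F : Type*} [Field F] {E : Type*} [Ring E] [Algebra F E]

/-- The two-sided ideal generated by a subspace of a unital algebra. -/
def twoSidedSpan (U : Submodule F E) : Submodule F E := ⊤ * U * ⊤

theorem mul_mul_mem_twoSidedSpan {U : Submodule F E} {u : E} (hu : u ∈ U) (a b : E) :
    a * u * b ∈ twoSidedSpan U :=
  mul_mem_mul (mul_mem_mul mem_top hu) mem_top

theorem le_twoSidedSpan (U : Submodule F E) : U ≤ twoSidedSpan U := fun u hu => by
  simpa using mul_mul_mem_twoSidedSpan hu 1 1

theorem top_mul_top_submodule : (⊤ : Submodule F E) * ⊤ = ⊤ :=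
  top_unique fun x _ => by simpa using mul_mem_mul (mem_top (x := x)) (mem_top (x := (1 : E)))

theorem twoSidedSpan_mono {U V : Submodule F E} (h : U ≤ V) :
    twoSidedSpan U ≤ twoSidedSpan V :=
  mul_le_mul' (mul_le_mul' le_rfl h) le_rfl

theorem twoSidedSpan_sup (U V : Submodule F E) :
    twoSidedSpan (U ⊔ V) = twoSidedSpan U ⊔ twoSidedSpan V := by
  simp only [twoSidedSpan, Submodule.mul_sup, Submodule.sup_mul]

theorem top_mul_twoSidedSpan (U : Submodule F E) : ⊤ * twoSidedSpan U = twoSidedSpan U := by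
  rw [twoSidedSpan, ← mul_assoc, ← mul_assoc, top_mul_top_submodule]

theorem twoSidedSpan_mul_top (U : Submodule F E) : twoSidedSpan U * ⊤ = twoSidedSpan U := by
  rw [twoSidedSpan, mul_assoc, top_mul_top_submodule]

theorem mul_twoSidedSpan_le (V U : Submodule F E) : V * twoSidedSpan U ≤ twoSidedSpan U :=
  (mul_le_mul' le_top le_rfl).trans (top_mul_twoSidedSpan U).le

theorem twoSidedSpan_mul_le (U V : Submodule F E) : twoSidedSpan U * V ≤ twoSidedSpan U :=
  (mul_le_mul' le_rfl le_top).trans (twoSidedSpan_mul_top U).le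

theorem mul_mem_twoSidedSpan_left {U : Submodule F E} {x : E} (a : E)
    (hx : x ∈ twoSidedSpan U) : a * x ∈ twoSidedSpan U :=
  mul_twoSidedSpan_le ⊤ U (mul_mem_mul mem_top hx)

theorem mul_mem_twoSidedSpan_right {U : Submodule F E} {x : E} (a : E)
    (hx : x ∈ twoSidedSpan U) : x * a ∈ twoSidedSpan U :=
  twoSidedSpan_mul_le U ⊤ (mul_mem_mul hx mem_top)

theorem twoSidedSpan_le_of_le {U V : Submodule F E} (h : U ≤ twoSidedSpan V) :
    twoSidedSpan U ≤ twoSidedSpan V := by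
  refine (twoSidedSpan_mono h).trans ?_
  rw [twoSidedSpan, top_mul_twoSidedSpan, twoSidedSpan_mul_top]

theorem sup_twoSidedSpan_pow_le (V U : Submodule F E) (m : ℕ) :
    (V ⊔ twoSidedSpan U) ^ m ≤ V ^ m ⊔ twoSidedSpan U := by
  induction m with
  | zero => simp
  | succ m ih =>
    rw [pow_succ, pow_succ]
    refine (mul_le_mul' ih le_rfl).trans ?_
    rw [Submodule.sup_mul, Submodule.mul_sup]
    exact sup_le (sup_le le_sup_left ((mul_twoSidedSpan_le _ _).trans le_sup_right))
      ((twoSidedSpan_mul_le _ _).trans le_sup_right)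

theorem exists_sup_pow_le {U V J : Submodule F E}
    (hU : ∃ n, twoSidedSpan U ^ n ≤ twoSidedSpan J)
    (hV : ∃ n, twoSidedSpan V ^ n ≤ twoSidedSpan J) :
    ∃ n, twoSidedSpan (U ⊔ V) ^ n ≤ twoSidedSpan J := by
  obtain ⟨m, hm⟩ := hU
  obtain ⟨n, hn⟩ := hV
  refine ⟨m * n, ?_⟩
  rw [twoSidedSpan_sup, pow_mul]
  calc ((twoSidedSpan U ⊔ twoSidedSpan V) ^ m) ^ n
      ≤ (twoSidedSpan V ⊔ twoSidedSpan J) ^ n := by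
        gcongr
        refine (sup_twoSidedSpan_pow_le _ _ m).trans ?_
        rw [sup_comm]
        exact sup_le_sup le_rfl hm
    _ ≤ twoSidedSpan V ^ n ⊔ twoSidedSpan J := sup_twoSidedSpan_pow_le _ _ n
    _ ≤ twoSidedSpan J := sup_le hn le_rfl

theorem exists_twoSidedSpan_span_pow_le {X : Set E} (hX : X.Finite) {J : Submodule F E}
    (h : ∀ x ∈ X, ∃ n, twoSidedSpan (span F {x}) ^ n ≤ twoSidedSpan J) :
    ∃ n, twoSidedSpan (span F X) ^ n ≤ twoSidedSpan J := by
  induction X, hX using Set.Finite.induction_on with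
  | empty => exact ⟨1, by simp [twoSidedSpan]⟩
  | @insert a X _ _ ih =>
    rw [span_insert]
    exact exists_sup_pow_le (h a (by simp)) (ih fun x hx => h x (by simp [hx]))

/-- Herstein: a Lie ideal `U` contains the commutators of the two-sided ideal generated
by `[U, U]` with the whole algebra. -/
theorem mul_sub_mul_mem_of_mem_twoSidedSpan_commSpan {U : Submodule F E}
    (hU : ∀ u ∈ U, ∀ a : E, u * a - a * u ∈ U) {x : E}
    (hx : x ∈ twoSidedSpan (commSpan F U U)) (a : E) : x * a - a * x ∈ U := by
  let T : Submodule F E :=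
    { carrier := {t | ∀ a, t * a - a * t ∈ U}
      add_mem' := fun {s t} hs ht a => by
        rw [show (s + t) * a - a * (s + t) = (s * a - a * s) + (t * a - a * t) by noncomm_ring]
        exact add_mem (hs a) (ht a)
      zero_mem' := fun a => by simp
      smul_mem' := fun r t ht a => by
        rw [smul_mul_assoc, mul_smul_comm, ← smul_sub]
        exact U.smul_mem r (ht a) }
  have hUT : U ≤ T := hU
  have hmul : ∀ s ∈ T, ∀ t ∈ T, s * t ∈ T := fun s hs t ht a => by
    rw [show s * t * a - a * (s * t) =
      (s * (t * a) - t * a * s) + (t * (a * s) - a * s * t) by noncomm_ring]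
    exact add_mem (hs _) (ht _)
  have hright : ∀ u ∈ U, ∀ v ∈ U, ∀ a, (u * v - v * u) * a ∈ T := fun u hu v hv a => by
    rw [show (u * v - v * u) * a = (u * (v * a) - v * a * u) - v * (u * a - a * u) by
      noncomm_ring]
    exact sub_mem (hUT (hU u hu _)) (hmul v (hUT hv) _ (hUT (hU u hu a)))
  have hboth : ∀ u ∈ U, ∀ v ∈ U, ∀ b a, b * (u * v - v * u) * a ∈ T := fun u hu v hv b a => by
    rw [show b * (u * v - v * u) * a = (u * v - v * u) * (a * b) -
      ((u * v - v * u) * a * b - b * ((u * v - v * u) * a)) by noncomm_ring]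
    exact sub_mem (hright u hu v hv _) (hUT (hright u hu v hv a b))
  have hle : twoSidedSpan (commSpan F U U) ≤ T := by
    rw [twoSidedSpan, commSpan, ← span_univ, span_mul_span, span_mul_span, span_le]
    rintro _ ⟨_, ⟨b, -, _, ⟨u, hu, v, hv, rfl⟩, rfl⟩, c, -, rfl⟩
    exact hboth u hu v hv b c
  exact hle hx a

/-- An element whose derivation squares to zero modulo an ideal `J` has products of its
commutators in `J`. -/
theorem comm_mul_comm_mem {J : Submodule F E} (h2 : (2 : F) ≠ 0) {u : E}
    (hu : ∀ a, u * (u * a - a * u) - (u * a - a * u) * u ∈ twoSidedSpan J) (a c b : E) :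
    (u * a - a * u) * c * (u * b - b * u) ∈ twoSidedSpan J := by
  have key : ∀ a b, (u * a - a * u) * (u * b - b * u) ∈ twoSidedSpan J := fun a b => by
    have h : (2 : F) • ((u * a - a * u) * (u * b - b * u)) ∈ twoSidedSpan J := by
      rw [two_smul, show (u * a - a * u) * (u * b - b * u) + (u * a - a * u) * (u * b - b * u) =
        (u * (u * (a * b) - a * b * u) - (u * (a * b) - a * b * u) * u) -
        (u * (u * a - a * u) - (u * a - a * u) * u) * b -
        a * (u * (u * b - b * u) - (u * b - b * u) * u) by noncomm_ring]
      exact sub_mem (sub_mem (hu _) (mul_mem_twoSidedSpan_right _ (hu a)))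
        (mul_mem_twoSidedSpan_left _ (hu b))
    simpa [smul_smul, inv_mul_cancel₀ h2] using Submodule.smul_mem _ (2 : F)⁻¹ h
  rw [show (u * a - a * u) * c * (u * b - b * u) =
    (u * (a * c) - a * c * u) * (u * b - b * u) -
      a * ((u * c - c * u) * (u * b - b * u)) by noncomm_ring]
  exact sub_mem (key _ _) (mul_mem_twoSidedSpan_left _ (key _ _))

theorem comm_mem_of_adjoin_eq_top {S : Set E} (hS : Algebra.adjoin F S = ⊤)
    {P : Submodule F E} {u : E} (h : ∀ s ∈ S, u * s - s * u ∈ twoSidedSpan P) (a : E) :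
    u * a - a * u ∈ twoSidedSpan P := by
  have ha : a ∈ Algebra.adjoin F S := hS ▸ trivial
  induction ha using Algebra.adjoin_induction with
  | mem s hs => exact h s hs
  | algebraMap r => rw [Algebra.commutes, sub_self]; exact zero_mem _
  | add x y _ _ hx hy =>
    rw [show u * (x + y) - (x + y) * u = (u * x - x * u) + (u * y - y * u) by noncomm_ring]
    exact add_mem hx hy
  | mul x y _ _ hx hy =>
    rw [show u * (x * y) - (x * y) * u = (u * x - x * u) * y + x * (u * y - y * u) by
      noncomm_ring]
    exact add_mem (mul_mem_twoSidedSpan_right _ hx) (mul_mem_twoSidedSpan_left _ hy)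

theorem exists_twoSidedSpan_singleton_pow_le_of_comm_mem {P : Submodule F E} {u : E}
    (hu : IsNilpotent u) (h : ∀ a, u * a - a * u ∈ twoSidedSpan P) :
    ∃ n, twoSidedSpan (span F {u}) ^ n ≤ twoSidedSpan P := by
  have hcomm : span F {u} * ⊤ ≤ ⊤ * span F {u} ⊔ twoSidedSpan P := by
    rw [← span_univ, span_mul_span, span_le]
    rintro _ ⟨x, hx, a, -, rfl⟩
    dsimp only
    rw [Set.mem_singleton_iff.1 hx, SetLike.mem_coe, show u * a = a * u + (u * a - a * u) by noncomm_ring]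
    exact add_mem (mem_sup_left (mul_mem_mul (subset_span trivial) (mem_span_singleton_self u)))
      (mem_sup_right (h a))
  have hid : twoSidedSpan (span F {u}) ≤ ⊤ * span F {u} ⊔ twoSidedSpan P := by
    rw [twoSidedSpan, mul_assoc]
    refine (mul_le_mul' le_rfl hcomm).trans ?_
    rw [Submodule.mul_sup, ← mul_assoc, top_mul_top_submodule, top_mul_twoSidedSpan]
  have hpow : ∀ m, (⊤ * span F {u}) ^ m ≤ ⊤ * span F {u} ^ m ⊔ twoSidedSpan P := by
    intro m
    induction m with
    | zero => simp
    | succ m ih =>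
      rw [pow_succ']
      refine (mul_le_mul' le_rfl ih).trans ?_
      rw [Submodule.mul_sup]
      refine sup_le ?_ ((mul_twoSidedSpan_le _ _).trans le_sup_right)
      rw [mul_assoc, ← mul_assoc (span F {u})]
      refine (mul_le_mul' le_rfl (mul_le_mul' hcomm le_rfl)).trans ?_
      rw [Submodule.sup_mul, Submodule.mul_sup]
      refine sup_le_sup ?_
        ((mul_le_mul' le_rfl (twoSidedSpan_mul_le _ _)).trans (mul_twoSidedSpan_le _ _))
      rw [mul_assoc, ← mul_assoc ⊤, top_mul_top_submodule, pow_succ']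
  obtain ⟨m, hm⟩ := hu
  refine ⟨m, ?_⟩
  calc twoSidedSpan (span F {u}) ^ m
      ≤ (⊤ * span F {u} ⊔ twoSidedSpan P) ^ m := by gcongr
    _ ≤ (⊤ * span F {u}) ^ m ⊔ twoSidedSpan P := sup_twoSidedSpan_pow_le _ _ m
    _ ≤ twoSidedSpan P := by
      refine sup_le ((hpow m).trans (sup_le ?_ le_rfl)) le_rfl
      rw [span_pow, Set.singleton_pow, hm]
      simp

/-- A nilpotent element of a Lie ideal `U` of a finitely generated algebra generates an ideal
that is nilpotent modulo the ideal generated by `[U, U]`. -/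
theorem exists_twoSidedSpan_singleton_pow_le {S : Set E} (hSf : S.Finite)
    (hS : Algebra.adjoin F S = ⊤) (h2 : (2 : F) ≠ 0) {U : Submodule F E}
    (hU : ∀ u ∈ U, ∀ a : E, u * a - a * u ∈ U) {u : E} (huU : u ∈ U) (hu : IsNilpotent u) :
    ∃ n, twoSidedSpan (span F {u}) ^ n ≤ twoSidedSpan (commSpan F U U) := by
  have hprod := comm_mul_comm_mem h2 fun a =>
    le_twoSidedSpan _ (mul_sub_mul_mem_commSpan (F := F) huU (hU u huU a))
  obtain ⟨m, hm⟩ := exists_twoSidedSpan_singleton_pow_le_of_comm_mem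
    (P := span F ((fun s => u * s - s * u) '' S)) hu
    (comm_mem_of_adjoin_eq_top hS fun s hs =>
      le_twoSidedSpan _ (subset_span (Set.mem_image_of_mem _ hs)))
  obtain ⟨n, hn⟩ := exists_twoSidedSpan_span_pow_le (F := F) (J := commSpan F U U)
    (hSf.image fun s => u * s - s * u) (by
      rintro _ ⟨s, -, rfl⟩
      refine ⟨2, ?_⟩
      have h : span F {u * s - s * u} * ⊤ * span F {u * s - s * u} ≤
          twoSidedSpan (commSpan F U U) := by
        rw [← span_univ, span_mul_span, span_mul_span, span_le]
        rintro _ ⟨_, ⟨_, rfl, c, -, rfl⟩, _, rfl, rfl⟩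
        exact hprod s c s
      calc twoSidedSpan (span F {u * s - s * u}) ^ 2
          = twoSidedSpan (span F {u * s - s * u} * ⊤ * span F {u * s - s * u}) := by
            simp only [twoSidedSpan, pow_two, mul_assoc]
            rw [← mul_assoc ⊤ ⊤, top_mul_top_submodule]
        _ ≤ _ := twoSidedSpan_le_of_le h)
  exact ⟨m * n, by
    rw [pow_mul]
    exact (pow_le_pow_left' hm n).trans hn⟩

end TwoSided

section NilpotentGenerators

variable {F : Type*} [Field F] {E : Type*} [Ring E] [Algebra F E]

theorem exists_finite_subset_mem_twoSidedSpan {Y : Set E} {x : E}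
    (hx : x ∈ twoSidedSpan (span F Y)) :
    ∃ Z ⊆ Y, Z.Finite ∧ x ∈ twoSidedSpan (span F Z) := by
  rw [twoSidedSpan, ← span_univ, span_mul_span, span_mul_span] at hx
  induction hx using span_induction with
  | mem x hx =>
    obtain ⟨_, ⟨a, -, y, hy, rfl⟩, b, -, rfl⟩ := hx
    exact ⟨{y}, by simpa using hy, Set.finite_singleton y,
      mul_mul_mem_twoSidedSpan (mem_span_singleton_self y) a b⟩
  | zero => exact ⟨∅, by simp, Set.finite_empty, zero_mem _⟩
  | add x y _ _ hx hy =>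
    obtain ⟨Z, hZ, hZf, hxZ⟩ := hx
    obtain ⟨Z', hZ', hZf', hyZ⟩ := hy
    exact ⟨Z ∪ Z', Set.union_subset hZ hZ', hZf.union hZf', add_mem
      (twoSidedSpan_mono (span_mono Set.subset_union_left) hxZ)
      (twoSidedSpan_mono (span_mono Set.subset_union_right) hyZ)⟩
  | smul r x _ hx =>
    obtain ⟨Z, hZ, hZf, hxZ⟩ := hx
    exact ⟨Z, hZ, hZf, Submodule.smul_mem _ r hxZ⟩

theorem exists_finite_subset_le_twoSidedSpan {Y : Set E} {V : Submodule F E} (hV : V.FG)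
    (h : V ≤ twoSidedSpan (span F Y)) :
    ∃ Z ⊆ Y, Z.Finite ∧ V ≤ twoSidedSpan (span F Z) := by
  obtain ⟨T, rfl⟩ := hV
  choose! f hfY hff hf using fun x (hx : x ∈ T) =>
    exists_finite_subset_mem_twoSidedSpan (h (subset_span hx))
  refine ⟨⋃ x ∈ T, f x, Set.iUnion₂_subset hfY, T.finite_toSet.biUnion hff, span_le.2 ?_⟩
  exact fun x hx => twoSidedSpan_mono
    (span_mono (Set.subset_biUnion_of_mem (u := f) (Finset.mem_coe.1 hx))) (hf x hx)

theorem span_insert_one_eq_top {S H : Set E} (hS : Algebra.adjoin F S = ⊤) (hSH : S ⊆ H)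
    (hmul : ∀ x ∈ H, ∀ y ∈ H, x * y ∈ H) : span F (insert 1 H) = ⊤ := by
  let N : Submonoid E :=
    { carrier := insert 1 H
      one_mem' := Set.mem_insert _ _
      mul_mem' := by
        rintro x y (rfl | hx) (rfl | hy)
        · simp
        · simpa using Or.inr hy
        · simpa using Or.inr hx
        · exact Or.inr (hmul x hx y hy) }
  have h : Submonoid.closure S ≤ N :=
    Submonoid.closure_le.2 (hSH.trans (Set.subset_insert _ _))
  rw [eq_top_iff, ← Algebra.top_toSubmodule, ← hS, Algebra.adjoin_eq_span]
  exact span_mono h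

theorem derivedPower_succ_le_span {H : Set E} (hH : span F (insert 1 H) = ⊤)
    (hcomm : ∀ x ∈ H, ∀ y ∈ H, x * y - y * x ∈ H) (k : ℕ) :
    derivedPower F E (k + 1) ≤ span F (H ∩ derivedPower F E (k + 1)) := by
  induction k with
  | zero =>
    have h : commSpan F (⊤ : Submodule F E) ⊤ ≤ span F (H ∩ derivedPower F E 1) := by
      rw [← hH]
      refine commSpan_span_le ?_
      rintro x (rfl | hx) y (rfl | hy)
      · simp
      · simp
      · simp
      · exact subset_span ⟨hcomm x hx y hy,
          mul_sub_mul_mem_commSpan (U := ⊤) (V := ⊤) trivial trivial⟩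
    exact h
  | succ k ih =>
    refine (commSpan_mono ih ih).trans (commSpan_span_le ?_)
    rintro x ⟨hx, hx'⟩ y ⟨hy, hy'⟩
    exact subset_span ⟨hcomm x hx y hy, mul_sub_mul_mem_commSpan hx' hy'⟩

/-- In a finitely generated unital algebra whose augmentation part is spanned by a set of
nilpotent elements closed under products and commutators, the ideal generated by any derived
power contains all sufficiently long words in the generators. -/
theorem exists_pow_le_twoSidedSpan_derivedPower {S H : Set E} (hSf : S.Finite)
    (hS : Algebra.adjoin F S = ⊤) (h2 : (2 : F) ≠ 0) (hSH : S ⊆ H)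
    (hmul : ∀ x ∈ H, ∀ y ∈ H, x * y ∈ H) (hcomm : ∀ x ∈ H, ∀ y ∈ H, x * y - y * x ∈ H)
    (hnil : ∀ x ∈ H, IsNilpotent x) (k : ℕ) :
    ∃ N, span F S ^ N ≤ twoSidedSpan (derivedPower F E k) := by
  suffices h : ∃ N, span F S ^ N ≤ twoSidedSpan (span F (H ∩ derivedPower F E k)) by
    obtain ⟨N, hN⟩ := h
    exact ⟨N, hN.trans (twoSidedSpan_mono (span_le.2 Set.inter_subset_right))⟩
  induction k with
  | zero =>
    refine ⟨1, ?_⟩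
    rw [pow_one]
    exact (span_mono (Set.subset_inter hSH (Set.subset_univ _))).trans (le_twoSidedSpan _)
  | succ k ih =>
    obtain ⟨N, hN⟩ := ih
    obtain ⟨Z, hZ, hZf, hNZ⟩ :=
      exists_finite_subset_le_twoSidedSpan ((fg_span hSf).pow N) hN
    obtain ⟨n, hn⟩ := exists_twoSidedSpan_span_pow_le (F := F)
      (J := derivedPower F E (k + 1)) hZf fun u hu =>
        exists_twoSidedSpan_singleton_pow_le hSf hS h2 (derivedPower_isLieIdeal k)
          (hZ hu).2 (hnil u (hZ hu).1)
    refine ⟨N * n, ?_⟩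
    rw [pow_mul]
    exact (pow_le_pow_left' hNZ n).trans (hn.trans (twoSidedSpan_mono
      (derivedPower_succ_le_span (span_insert_one_eq_top hS hSH hmul) hcomm k)))

end NilpotentGenerators

section Graded

open Polynomial

variable {F : Type*} [Field F] {B : Type*} [Ring B] [Algebra F B]

/-- The span of the `i`-fold nested commutators of words in `M` of total length `n`. -/
def gradedDerivedPower (M : Submodule F B) : ℕ → ℕ → Submodule F B
  | 0, n => M ^ n
  | i + 1, n => ⨆ p ∈ Finset.HasAntidiagonal.antidiagonal n,
      commSpan F (gradedDerivedPower M i p.1) (gradedDerivedPower M i p.2)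

theorem gradedDerivedPower_succ_le {M W : Submodule F B} {i n : ℕ} :
    gradedDerivedPower M (i + 1) n ≤ W ↔ ∀ p q, p + q = n →
      commSpan F (gradedDerivedPower M i p) (gradedDerivedPower M i q) ≤ W := by
  simp [gradedDerivedPower]

theorem commSpan_le_gradedDerivedPower (M : Submodule F B) (i p q : ℕ) :
    commSpan F (gradedDerivedPower M i p) (gradedDerivedPower M i q) ≤
      gradedDerivedPower M (i + 1) (p + q) :=
  gradedDerivedPower_succ_le.1 le_rfl p q rfl

theorem gradedDerivedPower_succ_le_self (M : Submodule F B) (i n : ℕ) :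
    gradedDerivedPower M (i + 1) n ≤ gradedDerivedPower M i n := by
  induction i generalizing n with
  | zero =>
    rw [gradedDerivedPower_succ_le]
    rintro p q rfl
    refine commSpan_le.2 fun u hu v hv => sub_mem ?_ ?_
    · rw [gradedDerivedPower, pow_add]
      exact mul_mem_mul hu hv
    · rw [add_comm, gradedDerivedPower, pow_add]
      exact mul_mem_mul hv hu
  | succ i ih =>
    rw [gradedDerivedPower_succ_le]
    rintro p q rfl
    exact (commSpan_mono (ih p) (ih q)).trans (commSpan_le_gradedDerivedPower M i p q)

theorem gradedDerivedPower_succ_le_one (M : Submodule F B) (i n : ℕ) :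
    gradedDerivedPower M (i + 1) n ≤ gradedDerivedPower M 1 n := by
  induction i with
  | zero => exact le_rfl
  | succ i ih => exact (gradedDerivedPower_succ_le_self M _ n).trans ih

theorem gradedDerivedPower_le_pow (M : Submodule F B) (i n : ℕ) :
    gradedDerivedPower M i n ≤ M ^ n := by
  induction i with
  | zero => rw [gradedDerivedPower]
  | succ i ih => exact (gradedDerivedPower_succ_le_self M _ n).trans ih

theorem mul_sub_mul_eq_zero_of_mem_one {u : B} (hu : u ∈ (1 : Submodule F B)) (v : B) :
    u * v - v * u = 0 := by
  obtain ⟨r, rfl⟩ := mem_one.1 hu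
  rw [Algebra.commutes, sub_self]

theorem commSpan_pow_pow_le (M : Submodule F B) (p q m : ℕ) (h : p + q = m + 1) :
    commSpan F (M ^ p) (M ^ q) ≤ commSpan F M (M ^ m) := by
  induction p generalizing q with
  | zero =>
    refine commSpan_le.2 fun u hu v _ => ?_
    rw [mul_sub_mul_eq_zero_of_mem_one (by simpa using hu)]
    exact zero_mem _
  | succ p ih =>
    obtain rfl : m = p + q := by omega
    refine commSpan_le.2 fun u hu v hv => ?_
    rw [pow_succ'] at hu
    induction hu using Submodule.mul_induction_on' with
    | mem_mul_mem a ha b hb =>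
      rw [show a * b * v - v * (a * b) =
        (a * (b * v) - b * v * a) + (b * (v * a) - v * a * b) by noncomm_ring]
      refine add_mem (mul_sub_mul_mem_commSpan ha ?_)
        (ih (q + 1) (by omega) (mul_sub_mul_mem_commSpan hb ?_))
      · exact (pow_add M p q).symm ▸ mul_mem_mul hb hv
      · exact (pow_succ M q).symm ▸ mul_mem_mul hv ha
    | add x _ y _ hx hy =>
      rw [show (x + y) * v - v * (x + y) = (x * v - v * x) + (y * v - v * y) by noncomm_ring]
      exact add_mem hx hy

theorem gradedDerivedPower_one_succ_le (M : Submodule F B) (m : ℕ) :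
    gradedDerivedPower M 1 (m + 1) ≤ commSpan F M (M ^ m) :=
  gradedDerivedPower_succ_le.2 fun p q h => by
    simpa only [gradedDerivedPower] using commSpan_pow_pow_le M p q m h

theorem gradedDerivedPower_succ_zero (M : Submodule F B) (i : ℕ) :
    gradedDerivedPower M (i + 1) 0 = ⊥ := by
  refine eq_bot_iff.2 ((gradedDerivedPower_succ_le_one M i 0).trans
    (gradedDerivedPower_succ_le.2 fun p q h => commSpan_le.2 fun u hu v _ => ?_))
  obtain rfl : p = 0 := by omega
  rw [gradedDerivedPower, pow_zero] at hu
  rw [mul_sub_mul_eq_zero_of_mem_one hu]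
  exact zero_mem _

theorem gradedDerivedPower_le_derivedPower (M : Submodule F B) (i n : ℕ) :
    gradedDerivedPower M i n ≤ derivedPower F B i := by
  induction i generalizing n with
  | zero => exact le_top
  | succ i ih => exact gradedDerivedPower_succ_le.2 fun p q _ => commSpan_mono (ih p) (ih q)

theorem derivedPower_le_iSup_gradedDerivedPower {S : Set B} (hS : Algebra.adjoin F S = ⊤)
    (i : ℕ) : derivedPower F B i ≤ ⨆ n, gradedDerivedPower (span F S) i n := by
  induction i with
  | zero =>
    rw [derivedPower, ← Algebra.top_toSubmodule, ← hS, Algebra.adjoin_eq_span, span_le]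
    intro x hx
    suffices h : ∃ n, x ∈ span F S ^ n by
      obtain ⟨n, hn⟩ := h
      exact mem_iSup_of_mem n (by rwa [gradedDerivedPower])
    induction hx using Submonoid.closure_induction with
    | mem x hx => exact ⟨1, by simpa using subset_span hx⟩
    | one => exact ⟨0, by rw [pow_zero]; exact mem_one.2 ⟨1, map_one _⟩⟩
    | mul x y _ _ hx hy =>
      obtain ⟨p, hp⟩ := hx
      obtain ⟨q, hq⟩ := hy
      exact ⟨p + q, by rw [pow_add]; exact mul_mem_mul hp hq⟩
  | succ i ih =>
    refine (commSpan_mono ih ih).trans ?_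
    rw [iSup_eq_span]
    refine commSpan_span_le fun x hx y hy => ?_
    obtain ⟨p, hp⟩ := Set.mem_iUnion.1 hx
    obtain ⟨q, hq⟩ := Set.mem_iUnion.1 hy
    exact mem_iSup_of_mem (p + q)
      (commSpan_le_gradedDerivedPower _ i p q (mul_sub_mul_mem_commSpan hp hq))

theorem coeff_mem_pow_of_mem_adjoin {S : Set B} {x : B[X]}
    (hx : x ∈ Algebra.adjoin F (monomial 1 '' S : Set B[X])) (n : ℕ) :
    x.coeff n ∈ span F S ^ n := by
  induction hx using Algebra.adjoin_induction generalizing n with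
  | mem x hx =>
    obtain ⟨s, hs, rfl⟩ := hx
    rw [coeff_monomial]
    split_ifs with h
    · subst h
      simpa using subset_span hs
    · exact zero_mem _
  | algebraMap r =>
    rw [Polynomial.algebraMap_apply, coeff_C]
    split_ifs with h
    · subst h
      rw [pow_zero]
      exact mem_one.2 ⟨r, rfl⟩
    · exact zero_mem _
  | add x y _ _ hx hy =>
    rw [coeff_add]
    exact add_mem (hx n) (hy n)
  | mul x y _ _ hx hy =>
    rw [coeff_mul]
    refine sum_mem fun p hp => ?_
    rw [← Finset.HasAntidiagonal.mem_antidiagonal.1 hp, pow_add]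
    exact mul_mem_mul (hx _) (hy _)

theorem coeff_mem_gradedDerivedPower {S : Set B} (i : ℕ)
    {x : Algebra.adjoin F (monomial 1 '' S : Set B[X])} (hx : x ∈ derivedPower F _ i) (n : ℕ) :
    (x : B[X]).coeff n ∈ gradedDerivedPower (span F S) i n := by
  induction i generalizing x n with
  | zero =>
    rw [gradedDerivedPower]
    exact coeff_mem_pow_of_mem_adjoin x.2 n
  | succ i ih =>
    rw [derivedPower, commSpan] at hx
    induction hx using span_induction with
    | mem x hx =>
      obtain ⟨u, hu, v, hv, rfl⟩ := hx
      have h : ((u * v - v * u : Algebra.adjoin F (monomial 1 '' S : Set B[X])) : B[X]).coeff n =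
          ∑ p ∈ Finset.HasAntidiagonal.antidiagonal n, ((u : B[X]).coeff p.1 * (v : B[X]).coeff p.2 -
            (v : B[X]).coeff p.2 * (u : B[X]).coeff p.1) := by
        rw [Finset.sum_sub_distrib, AddSubgroupClass.coe_sub, MulMemClass.coe_mul,
          MulMemClass.coe_mul, coeff_sub, coeff_mul, coeff_mul, ← Finset.Nat.sum_antidiagonal_swap
            (f := fun p => (v : B[X]).coeff p.1 * (u : B[X]).coeff p.2)]
        rfl
      rw [h]
      refine sum_mem fun p hp => ?_
      rw [← Finset.HasAntidiagonal.mem_antidiagonal.1 hp]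
      exact commSpan_le_gradedDerivedPower _ i _ _ (mul_sub_mul_mem_commSpan (ih hu _) (ih hv _))
    | zero => simp
    | add x y _ _ hx hy => simpa using add_mem hx hy
    | smul r x _ hx => simpa using Submodule.smul_mem _ r hx

theorem monomial_mem_span_pow {S : Set B} (m : ℕ) {w : B} (hw : w ∈ span F S ^ m) :
    monomial m w ∈ span F (monomial 1 '' S : Set B[X]) ^ m := by
  have hone : ∀ s ∈ span F S, monomial 1 s ∈ span F (monomial 1 '' S : Set B[X]) := by
    intro s hs
    induction hs using span_induction with
    | mem x hx => exact subset_span ⟨x, hx, rfl⟩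
    | zero => simp
    | add x y _ _ hx hy => rw [map_add]; exact add_mem hx hy
    | smul r x _ hx => rw [← smul_monomial]; exact Submodule.smul_mem _ r hx
  induction m generalizing w with
  | zero =>
    rw [pow_zero] at hw ⊢
    obtain ⟨r, rfl⟩ := mem_one.1 hw
    exact mem_one.2 ⟨r, rfl⟩
  | succ m ih =>
    rw [pow_succ] at hw ⊢
    induction hw using Submodule.mul_induction_on' with
    | mem_mul_mem a ha b hb =>
      rw [← monomial_mul_monomial]
      exact mul_mem_mul (ih ha) (hone b hb)
    | add x _ y _ hx hy => rw [map_add]; exact add_mem hx hy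

/-- If all homogeneous words are nilpotent, a commutator of a generator with a sufficiently long
word is a combination of nested commutators of words of the same total length. -/
theorem exists_commSpan_pow_le_gradedDerivedPower {S : Set B} (hSf : S.Finite)
    (h2 : (2 : F) ≠ 0) (hnil : ∀ n, n ≠ 0 → ∀ a ∈ span F S ^ n, IsNilpotent a) (i : ℕ) :
    ∃ N, ∀ m, N ≤ m →
      commSpan F (span F S) (span F S ^ m) ≤ gradedDerivedPower (span F S) i (m + 1) := by
  let E := Algebra.adjoin F (monomial 1 '' S : Set B[X])
  let SE : Set E := Subtype.val ⁻¹' (monomial 1 '' S : Set B[X])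
  let H : Set E := {x | ∃ n, n ≠ 0 ∧ ∃ a ∈ span F S ^ n, (x : B[X]) = monomial n a}
  have hSE : Algebra.adjoin F SE = ⊤ := Algebra.adjoin_adjoin_coe_preimage
  have hmul : ∀ x ∈ H, ∀ y ∈ H, x * y ∈ H := by
    rintro x ⟨p, hp, a, ha, hx⟩ y ⟨q, hq, b, hb, hy⟩
    refine ⟨p + q, by omega, a * b, by rw [pow_add]; exact mul_mem_mul ha hb, ?_⟩
    rw [MulMemClass.coe_mul, hx, hy, monomial_mul_monomial]
  have hcomm : ∀ x ∈ H, ∀ y ∈ H, x * y - y * x ∈ H := by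
    rintro x ⟨p, hp, a, ha, hx⟩ y ⟨q, hq, b, hb, hy⟩
    refine ⟨p + q, by omega, a * b - b * a, sub_mem ?_ ?_, ?_⟩
    · rw [pow_add]; exact mul_mem_mul ha hb
    · rw [add_comm, pow_add]; exact mul_mem_mul hb ha
    · rw [AddSubgroupClass.coe_sub, MulMemClass.coe_mul, MulMemClass.coe_mul, hx, hy,
        monomial_mul_monomial, monomial_mul_monomial, add_comm q p, map_sub]
  obtain ⟨N, hN⟩ := exists_pow_le_twoSidedSpan_derivedPower (F := F) (S := SE) (H := H)
    ((hSf.image _).preimage Subtype.val_injective.injOn) hSE h2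
    (by
      rintro x ⟨s, hs, hx⟩
      exact ⟨1, one_ne_zero, s, by simpa using subset_span hs, hx.symm⟩)
    hmul hcomm
    (by
      rintro x ⟨n, hn, a, ha, hx⟩
      obtain ⟨k, hk⟩ := hnil n hn a ha
      refine ⟨k, Subtype.ext ?_⟩
      rw [SubmonoidClass.coe_pow, hx, monomial_pow, hk, map_zero]
      rfl) (i + 1)
  refine ⟨N, fun m hm => ?_⟩
  rw [← span_eq (span F S ^ m)]
  refine commSpan_span_le fun s hs w hw => ?_
  have hsub : ((fun x : E => (x : B[X])) '' SE) = (monomial 1 '' S : Set B[X]) := by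
    exact (Subtype.image_preimage_coe _ _).trans (Set.inter_eq_right.2 Algebra.subset_adjoin)
  have hmap : (span F SE ^ m).map E.val.toLinearMap =
      span F (monomial 1 '' S : Set B[X]) ^ m := by
    rw [Submodule.map_pow, Submodule.map_span]
    exact congrArg (fun X => span F X ^ m) hsub
  obtain ⟨e, he, hew⟩ := hmap.symm ▸ monomial_mem_span_pow m hw
  let s' : E := ⟨monomial 1 s, Algebra.subset_adjoin ⟨s, hs, rfl⟩⟩
  have hem : e ∈ twoSidedSpan (derivedPower F E (i + 1)) := by
    obtain ⟨d, rfl⟩ := Nat.exists_eq_add_of_le hm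
    rw [pow_add] at he
    exact twoSidedSpan_mul_le _ _ (mul_le_mul' hN le_rfl he)
  have hmem := coeff_mem_gradedDerivedPower i
    (mul_sub_mul_mem_of_mem_twoSidedSpan_commSpan (derivedPower_isLieIdeal i) hem s') (m + 1)
  have hcoeff : ((e * s' - s' * e : E) : B[X]).coeff (m + 1) = w * s - s * w := by
    have hew' : (e : B[X]) = monomial m w := hew
    rw [AddSubgroupClass.coe_sub, MulMemClass.coe_mul, MulMemClass.coe_mul, hew',
      monomial_mul_monomial, monomial_mul_monomial, add_comm 1 m, ← map_sub,
      coeff_monomial_same]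
  rw [hcoeff] at hmem
  rw [← neg_sub]
  exact neg_mem hmem

theorem exists_finset_lieClosure_eq_derivedPower {S : Set B} (hSf : S.Finite)
    (hS : Algebra.adjoin F S = ⊤) (h2 : (2 : F) ≠ 0)
    (hnil : ∀ n, n ≠ 0 → ∀ a ∈ span F S ^ n, IsNilpotent a) (i : ℕ) :
    ∃ T : Finset B, (T : Set B) ⊆ derivedPower F B (i + 1) ∧
      lieClosure F (T : Set B) = derivedPower F B (i + 1) := by
  obtain ⟨N, hN⟩ := exists_commSpan_pow_le_gradedDerivedPower hSf h2 hnil (i + 2)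
  set W := gradedDerivedPower (span F S) (i + 1)
  have hfg : (⨆ n ∈ Finset.range (N + 1), W n).FG := by
    refine fg_biSup _ _ fun n _ => ?_
    have : FiniteDimensional F (span F S ^ n : Submodule F B) :=
      Module.Finite.iff_fg.2 ((fg_span hSf).pow n)
    exact Module.Finite.iff_fg.1
      (Submodule.finiteDimensional_of_le (gradedDerivedPower_le_pow _ (i + 1) n))
  obtain ⟨T, hT⟩ := hfg
  have hTD : (T : Set B) ⊆ derivedPower F B (i + 1) := by
    refine subset_span.trans (?_ : span F (T : Set B) ≤ _)
    rw [hT]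
    exact iSup₂_le fun n _ => gradedDerivedPower_le_derivedPower _ _ n
  refine ⟨T, hTD, le_antisymm
    (lieClosure_le hTD fun x hx y hy => derivedPower_mul_sub_mul_mem hx hy)
    ((derivedPower_le_iSup_gradedDerivedPower hS (i + 1)).trans (iSup_le fun n => ?_))⟩
  change W n ≤ _
  induction n using Nat.strong_induction_on with
  | _ n ih =>
    rcases lt_or_ge N n with h | h
    · obtain ⟨m, rfl⟩ : ∃ m, n = m + 1 := ⟨n - 1, by omega⟩
      refine (gradedDerivedPower_succ_le_one _ i _).trans
        ((gradedDerivedPower_one_succ_le _ m).trans ((hN m (by omega)).trans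
        (gradedDerivedPower_succ_le.2 fun p q hpq => commSpan_le.2 fun u hu v hv => ?_)))
      rcases Nat.eq_zero_or_pos p with rfl | hp
      · rw [gradedDerivedPower_succ_zero, mem_bot] at hu
        simp [hu]
      rcases Nat.eq_zero_or_pos q with rfl | hq
      · rw [gradedDerivedPower_succ_zero, mem_bot] at hv
        simp [hv]
      exact lieClosure_mul_sub_mul_mem (ih p (by omega) hu) (ih q (by omega) hv)
    · refine (?_ : W n ≤ span F (T : Set B)).trans (span_le.2 (subset_lieClosure _))
      rw [hT]
      exact le_iSup₂_of_le n (Finset.mem_range.2 (by omega)) le_rfl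

end Graded

section Unitization

variable {F : Type*} [Field F] {A : Type*} [NonUnitalRing A] [Module F A]
  [SMulCommClass F A A] [IsScalarTower F A A]

theorem adjoin_inr_eq_top {S : Set A} (hS : algClosure F S = ⊤) :
    Algebra.adjoin F (Unitization.inr '' S : Set (Unitization F A)) = ⊤ := by
  have hle : algClosure F S ≤ (Subalgebra.toSubmodule (Algebra.adjoin F
      (Unitization.inr '' S : Set (Unitization F A)))).comap (Unitization.inrHom F F A) := by
    refine sInf_le ⟨fun s hs => Algebra.subset_adjoin ⟨s, hs, rfl⟩, fun x hx y hy => ?_⟩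
    rw [mem_comap, Subalgebra.mem_toSubmodule] at *
    rw [Unitization.inrHom_apply, Unitization.inr_mul]
    exact mul_mem hx hy
  refine eq_top_iff.2 fun x _ => ?_
  rw [← Unitization.inl_fst_add_inr_snd_eq x]
  exact add_mem (Subalgebra.algebraMap_mem _ x.fst) (hle (hS ▸ mem_top))

theorem inr_nuPow (a : A) (n : ℕ) :
    (Unitization.inr (nuPow a n) : Unitization F A) = Unitization.inr a ^ (n + 1) := by
  induction n with
  | zero => simp [nuPow]
  | succ n ih => rw [nuPow, Unitization.inr_mul, ih, ← pow_succ']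

theorem map_inrHom_commSpan (U V : Submodule F A) :
    (commSpan F U V).map (Unitization.inrHom F F A) =
      commSpan F (U.map (Unitization.inrHom F F A)) (V.map (Unitization.inrHom F F A)) := by
  refine le_antisymm (map_le_iff_le_comap.2 (commSpan_le.2 fun u hu v hv => ?_))
    (commSpan_le.2 ?_)
  · simpa using mul_sub_mul_mem_commSpan (mem_map_of_mem (f := Unitization.inrHom F F A) hu)
      (mem_map_of_mem (f := Unitization.inrHom F F A) hv)
  · rintro _ ⟨u, hu, rfl⟩ _ ⟨v, hv, rfl⟩
    exact ⟨u * v - v * u, mul_sub_mul_mem_commSpan hu hv, by simp⟩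

theorem derivedPower_unitization_succ (i : ℕ) :
    derivedPower F (Unitization F A) (i + 1) =
      (derivedPower F A (i + 1)).map (Unitization.inrHom F F A) := by
  induction i with
  | zero =>
    refine le_antisymm (commSpan_le.2 fun u _ v _ => ?_) ?_
    · refine ⟨u.snd * v.snd - v.snd * u.snd, mul_sub_mul_mem_commSpan trivial trivial, ?_⟩
      refine Unitization.ext ?_ ?_
      · rw [sub_eq_add_neg (u * v), Unitization.inrHom_apply, Unitization.fst_inr]
        simp [mul_comm]
      · rw [sub_eq_add_neg (u * v)]
        simp only [Unitization.inrHom_apply, Unitization.snd_inr, Unitization.snd_add,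
          Unitization.snd_neg, Unitization.snd_mul]
        abel
    · exact (map_inrHom_commSpan _ _).le.trans (commSpan_mono le_top le_top)
  | succ i ih =>
    rw [derivedPower, ih]
    exact (map_inrHom_commSpan _ _).symm

theorem span_inr_pow_le_range (S : Set A) {n : ℕ} (hn : n ≠ 0) :
    span F (Unitization.inr '' S : Set (Unitization F A)) ^ n ≤
      LinearMap.range (Unitization.inrHom F F A) := by
  have h : span F (Unitization.inr '' S : Set (Unitization F A)) ≤
      LinearMap.range (Unitization.inrHom F F A) := by
    rw [span_le]
    rintro _ ⟨s, -, rfl⟩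
    exact ⟨s, rfl⟩
  induction n with
  | zero => exact absurd rfl hn
  | succ n ih =>
    rcases Nat.eq_zero_or_pos n with rfl | hpos
    · simpa using h
    rw [pow_succ]
    refine (mul_le_mul' (ih hpos.ne') h).trans (Submodule.mul_le.2 ?_)
    rintro _ ⟨a, rfl⟩ _ ⟨b, rfl⟩
    exact ⟨a * b, by simp⟩

end Unitization

/-- Let `A` be a finitely generated nil associative algebra over a field of
characteristic `≠ 2`.  Then every Lie derived power `A^{[i]}`, `i ≥ 1`, is a finitely
generated Lie algebra. -/
theorem derivedPower_finitelyGenerated_of_nil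
    (F : Type*) [Field F] (hchar : ringChar F ≠ 2)
    (A : Type*) [NonUnitalRing A] [Module F A] [SMulCommClass F A A] [IsScalarTower F A A]
    (hfg : ∃ S : Finset A, algClosure F (↑S : Set A) = ⊤)
    (hnil : ∀ a : A, ∃ n : ℕ, nuPow a n = 0)
    (i : ℕ) (hi : 1 ≤ i) :
    ∃ T : Finset A, (↑T : Set A) ⊆ (derivedPower F A i : Set A) ∧
      lieClosure F (↑T : Set A) = derivedPower F A i := by
  obtain ⟨S, hS⟩ := hfg
  obtain ⟨i, rfl⟩ : ∃ j, i = j + 1 := ⟨i - 1, by omega⟩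
  set f := Unitization.inrHom F F A with hf
  have hinj : Function.Injective f := Unitization.inr_injective
  obtain ⟨T, hTD, hT⟩ := exists_finset_lieClosure_eq_derivedPower
    (S.finite_toSet.image (Unitization.inr (R := F))) (adjoin_inr_eq_top hS)
    (Ring.two_ne_zero hchar) (by
      intro n hn a ha
      obtain ⟨b, rfl⟩ := span_inr_pow_le_range _ hn ha
      obtain ⟨k, hk⟩ := hnil b
      exact ⟨k + 1, by rw [Unitization.inrHom_apply, ← inr_nuPow, hk, Unitization.inr_zero]⟩) i
  have hfin : (f ⁻¹' (T : Set (Unitization F A))).Finite :=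
    T.finite_toSet.preimage hinj.injOn
  rw [derivedPower_unitization_succ] at hTD hT
  have hsub : f ⁻¹' (T : Set (Unitization F A)) ⊆ derivedPower F A (i + 1) := by
    intro x hx
    obtain ⟨y, hy, hyx⟩ := hTD hx
    exact hinj hyx ▸ hy
  refine ⟨hfin.toFinset, by simpa using hsub, ?_⟩
  rw [Set.Finite.coe_toFinset]
  refine le_antisymm (lieClosure_le hsub fun x hx y hy => derivedPower_mul_sub_mul_mem hx hy) ?_
  have hle : lieClosure F (T : Set (Unitization F A)) ≤
      (lieClosure F (f ⁻¹' (T : Set (Unitization F A)))).map f := by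
    refine lieClosure_le (fun x hx => ?_) ?_
    · obtain ⟨y, -, rfl⟩ := hTD hx
      exact mem_map_of_mem (subset_lieClosure _ hx)
    · rintro _ ⟨x, hx, rfl⟩ _ ⟨y, hy, rfl⟩
      exact ⟨x * y - y * x, lieClosure_mul_sub_mul_mem hx hy, by simp [hf]⟩
  rw [hT] at hle
  exact (map_le_map_iff_of_injective hinj _ _).1 hle
end

section
/- Let A be an associative algebra over a field of characteristic ≠ 2 and let U be an ideal of the Lie algebra A^(-) (i.e., a subspace with [U, A] ⊆ U). Then [id_A([U,U]), A] ⊆ U, where id_A([U,U]) is the two-sided associative ideal of A generated by the subspace [U,U]. -/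
/-- The two-sided associative ideal of `A` generated by a set `S`
(the smallest subspace containing `S` that is closed under left and right
multiplication by arbitrary elements of `A`). -/
def algIdealGen (F : Type*) [Field F] {A : Type*} [NonUnitalRing A] [Module F A]
    [SMulCommClass F A A] [IsScalarTower F A A] (S : Set A) : Submodule F A :=
  sInf {p : Submodule F A | S ⊆ ↑p ∧ ∀ a : A, ∀ x ∈ p, a * x ∈ p ∧ x * a ∈ p}

section LieTransporter

variable {F : Type*} [Field F] {A : Type*} [NonUnitalRing A] [Module F A]
  [SMulCommClass F A A] [IsScalarTower F A A] {U : Submodule F A}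

/-- The subspace of all `t` with `[t, A] ⊆ U`. -/
def lieTransporter (U : Submodule F A) : Submodule F A where
  carrier := {t | ∀ a : A, t * a - a * t ∈ U}
  zero_mem' a := by simp
  add_mem' {s t} hs ht a := by
    have h : (s + t) * a - a * (s + t) = (s * a - a * s) + (t * a - a * t) := by noncomm_ring
    exact h ▸ U.add_mem (hs a) (ht a)
  smul_mem' c t ht a := by
    have h : c • t * a - a * c • t = c • (t * a - a * t) := by
      rw [smul_mul_assoc, mul_smul_comm, smul_sub]
    exact h ▸ U.smul_mem c (ht a)

theorem mul_mem_lieTransporter {s t : A} (hs : s ∈ lieTransporter U)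
    (ht : t ∈ lieTransporter U) : s * t ∈ lieTransporter U := fun a ↦ by
  have h : s * t * a - a * (s * t) =
      (s * (t * a) - t * a * s) + (t * (a * s) - a * s * t) := by noncomm_ring
  exact h ▸ U.add_mem (hs (t * a)) (ht (a * s))

/-- The largest two-sided ideal contained in `lieTransporter U` when `U` is a Lie ideal. -/
def lieTransporterCore (U : Submodule F A) : Submodule F A where
  carrier := {x | x ∈ lieTransporter U ∧ ∀ a : A, x * a ∈ lieTransporter U}
  zero_mem' := ⟨zero_mem _, fun a ↦ by simp⟩
  add_mem' hx hy := ⟨add_mem hx.1 hy.1, fun a ↦ by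
    rw [add_mul]; exact add_mem (hx.2 a) (hy.2 a)⟩
  smul_mem' c _ hx := ⟨Submodule.smul_mem _ c hx.1, fun a ↦ by
    rw [smul_mul_assoc]; exact Submodule.smul_mem _ c (hx.2 a)⟩

theorem mul_mem_lieTransporterCore (hU : U ≤ lieTransporter U) (a : A) {x : A}
    (hx : x ∈ lieTransporterCore U) :
    a * x ∈ lieTransporterCore U ∧ x * a ∈ lieTransporterCore U := by
  refine ⟨⟨?_, fun b ↦ ?_⟩, hx.2 a, fun b ↦ mul_assoc x a b ▸ hx.2 (a * b)⟩
  · have h : a * x = x * a - (x * a - a * x) := by abel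
    exact h ▸ sub_mem (hx.2 a) (hU (hx.1 a))
  · have h : a * x * b = x * (b * a) - (x * b * a - a * (x * b)) := by noncomm_ring
    exact h ▸ sub_mem (hx.2 (b * a)) (hU (hx.2 b a))

theorem commSpan_le_lieTransporterCore (hU : U ≤ lieTransporter U) :
    commSpan F U U ≤ lieTransporterCore U := by
  refine Submodule.span_le.2 ?_
  rintro _ ⟨u, hu, v, hv, rfl⟩
  refine ⟨hU (hU hu v), fun a ↦ ?_⟩
  have h : (u * v - v * u) * a = (u * (v * a) - v * a * u) - v * (u * a - a * u) := by
    noncomm_ring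
  exact h ▸ sub_mem (hU (hU hu (v * a))) (mul_mem_lieTransporter (hU hv) (hU (hU hu a)))

end LieTransporter

/-- Let `A` be an associative algebra over a field of characteristic `≠ 2`
and `U` an ideal of the Lie algebra `A⁽⁻⁾`.  Then `[id_A([U,U]), A] ⊆ U`. -/
theorem lie_ideal_comm_idealGen_subset
    (F : Type*) [Field F] (hchar : ringChar F ≠ 2)
    (A : Type*) [NonUnitalRing A] [Module F A] [SMulCommClass F A A] [IsScalarTower F A A]
    (U : Submodule F A) (hU : ∀ u ∈ U, ∀ a : A, u * a - a * u ∈ U) :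
    ∀ x ∈ algIdealGen F (commSpan F U U : Set A), ∀ a : A, x * a - a * x ∈ U := by
  intro x hx
  exact ((Submodule.mem_sInf.1 hx) (lieTransporterCore U)
    ⟨commSpan_le_lieTransporterCore hU, fun a _ ↦ mul_mem_lieTransporterCore hU a⟩).1
end

section
/- Let A be an associative algebra over a field of characteristic ≠ 2 that is generated (as an associative algebra) by a finite collection of nilpotent elements. Then for every k ≥ 1, the quotient algebra A / id_A(A^{[k]}) is nilpotent, where id_A(A^{[k]}) is the two-sided associative ideal of A generated by the k-th Lie derived power A^{[k]}. -/
/-- The linear span of all products `u * v` with `u ∈ U`, `v ∈ V`. -/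
def mulSpan (F : Type*) [Field F] {A : Type*} [NonUnitalRing A] [Module F A]
    [SMulCommClass F A A] [IsScalarTower F A A] (U V : Submodule F A) : Submodule F A :=
  Submodule.span F {x | ∃ u ∈ U, ∃ v ∈ V, x = u * v}

/-- `subPow F V n` is the span `V^{n+1}` of all products of `n + 1` elements of `V`. -/
def subPow (F : Type*) [Field F] {A : Type*} [NonUnitalRing A] [Module F A]
    [SMulCommClass F A A] [IsScalarTower F A A] (V : Submodule F A) : ℕ → Submodule F A
  | 0 => V
  | n + 1 => mulSpan F V (subPow F V n)

section Helpers

variable {F : Type*} [Field F] {A : Type*} [NonUnitalRing A] [Module F A]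
  [SMulCommClass F A A] [IsScalarTower F A A]

/-- A submodule that is a two-sided ideal. -/
def IsTwoSidedIdeal (I : Submodule F A) : Prop :=
  ∀ a : A, ∀ x ∈ I, a * x ∈ I ∧ x * a ∈ I

/-- An element whose commutators all lie in `I`. -/
def IsCentralMod (I : Submodule F A) (a : A) : Prop :=
  ∀ r : A, a * r - r * a ∈ I

/-- The semiprimeness condition `a A a ⊆ I → a ∈ I`. -/
def IsSemiprimeSubmodule (I : Submodule F A) : Prop :=
  ∀ a : A, (∀ x : A, a * x * a ∈ I) → a ∈ I

theorem isTwoSidedIdeal_algIdealGen (S : Set A) : IsTwoSidedIdeal (algIdealGen F S) := by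
  intro a x hx
  simp only [algIdealGen, Submodule.mem_sInf, Set.mem_ofPred_eq] at hx ⊢
  exact ⟨fun p hp => (hp.2 a x (hx p hp)).1, fun p hp => (hp.2 a x (hx p hp)).2⟩

theorem subset_algIdealGen (S : Set A) : S ⊆ algIdealGen F S := by
  intro x hx
  simp only [algIdealGen, SetLike.mem_coe, Submodule.mem_sInf, Set.mem_ofPred_eq]
  exact fun p hp => hp.1 hx

theorem algIdealGen_le {S : Set A} {I : Submodule F A} (hS : S ⊆ I) (hI : IsTwoSidedIdeal I) :
    algIdealGen F S ≤ I :=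
  sInf_le ⟨hS, hI⟩

theorem algClosure_le {S : Set A} {p : Submodule F A} (hS : S ⊆ p)
    (hp : ∀ x ∈ p, ∀ y ∈ p, x * y ∈ p) : algClosure F S ≤ p :=
  sInf_le ⟨hS, hp⟩

theorem mulSpan_le {U V W : Submodule F A} :
    mulSpan F U V ≤ W ↔ ∀ u ∈ U, ∀ v ∈ V, u * v ∈ W := by
  rw [mulSpan, Submodule.span_le]
  refine ⟨fun h u hu v hv => h ⟨u, hu, v, hv, rfl⟩, ?_⟩
  rintro h _ ⟨u, hu, v, hv, rfl⟩
  exact h u hu v hv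

theorem mul_mem_mulSpan {U V : Submodule F A} {u v : A} (hu : u ∈ U) (hv : v ∈ V) :
    u * v ∈ mulSpan F U V :=
  mulSpan_le.1 le_rfl u hu v hv

theorem mul_mem_subPow_top (n : ℕ) (y : A) {v : A} (hv : v ∈ subPow F (⊤ : Submodule F A) n) :
    y * v ∈ subPow F (⊤ : Submodule F A) n := by
  cases n with
  | zero => exact Submodule.mem_top
  | succ n =>
    have h : mulSpan F ⊤ (subPow F (⊤ : Submodule F A) n) ≤
        (mulSpan F ⊤ (subPow F (⊤ : Submodule F A) n)).comap (LinearMap.mulLeft F y) := by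
      refine mulSpan_le.2 fun u _ w hw => ?_
      rw [Submodule.mem_comap, LinearMap.mulLeft_apply, ← mul_assoc]
      exact mul_mem_mulSpan Submodule.mem_top hw
    exact h hv

theorem subPow_add_le (V : Submodule F A) (n m : ℕ) :
    subPow F V (n + m + 1) ≤ mulSpan F (subPow F V n) (subPow F V m) := by
  induction n with
  | zero => rw [Nat.zero_add]; exact le_rfl
  | succ n ih =>
    rw [show n + 1 + m + 1 = (n + m + 1) + 1 by ring]
    refine mulSpan_le.2 fun u hu v hv => ?_
    have h : mulSpan F (subPow F V n) (subPow F V m) ≤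
        (mulSpan F (subPow F V (n + 1)) (subPow F V m)).comap (LinearMap.mulLeft F u) := by
      refine mulSpan_le.2 fun p hp q hq => ?_
      rw [Submodule.mem_comap, LinearMap.mulLeft_apply, ← mul_assoc]
      exact mul_mem_mulSpan (mul_mem_mulSpan hu hp) hq
    exact h (ih hv)

/-- In a finitely generated algebra every power is finitely generated as a right ideal. -/
theorem exists_finset_subPow_top_le (S : Finset A) (hgen : algClosure F (S : Set A) = ⊤) (n : ℕ) :
    ∃ T : Finset A, (T : Set A) ⊆ subPow F (⊤ : Submodule F A) n ∧
      ∀ K : Submodule F A, (∀ x ∈ K, ∀ a : A, x * a ∈ K) → (T : Set A) ⊆ K →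
        subPow F (⊤ : Submodule F A) n ≤ K := by
  classical
  induction n with
  | zero =>
    refine ⟨S, fun _ _ => Submodule.mem_top, fun K hK hSK => ?_⟩
    rw [subPow, ← hgen]
    exact algClosure_le hSK fun x hx y _ => hK x hx y
  | succ n ih =>
    obtain ⟨T, hT, hTK⟩ := ih
    refine ⟨Finset.image₂ (· * ·) S T, ?_, fun K hK hSK => ?_⟩
    · intro x hx
      obtain ⟨s, _, t, ht, rfl⟩ := Finset.mem_image₂.1 hx
      exact mul_mem_mulSpan Submodule.mem_top (hT ht)
    · let L : Submodule F A :=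
        { carrier := {u | ∀ v ∈ subPow F (⊤ : Submodule F A) n, u * v ∈ K}
          add_mem' := fun {x y} hx hy v hv => by
            rw [add_mul]; exact K.add_mem (hx v hv) (hy v hv)
          zero_mem' := fun v _ => by rw [zero_mul]; exact K.zero_mem
          smul_mem' := fun c x hx v hv => by
            rw [smul_mul_assoc]; exact K.smul_mem c (hx v hv) }
      have hL : (⊤ : Submodule F A) ≤ L := by
        rw [← hgen]
        refine algClosure_le (fun s hs => ?_) fun x hx y _ v hv => ?_
        · refine hTK (K.comap (LinearMap.mulLeft F s)) (fun x hx a => ?_) fun t ht => ?_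
          · rw [Submodule.mem_comap, LinearMap.mulLeft_apply] at hx ⊢
            rw [← mul_assoc]
            exact hK _ hx a
          · exact hSK (Finset.mem_image₂_of_mem hs ht)
        · rw [mul_assoc]
          exact hx _ (mul_mem_subPow_top n y hv)
      exact mulSpan_le.2 fun u _ v hv => hL Submodule.mem_top v hv

omit [SMulCommClass F A A] [IsScalarTower F A A] in
/-- Inner derivations of square zero modulo a semiprime ideal are zero modulo that ideal. -/
theorem isCentralMod_of_ad_ad_mem {I : Submodule F A} (hI : IsTwoSidedIdeal I)
    (hsp : IsSemiprimeSubmodule I) (h2 : (2 : F) ≠ 0) {a : A}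
    (ha : ∀ x : A, a * (a * x - x * a) - (a * x - x * a) * a ∈ I) : IsCentralMod I a := by
  have hdd (x y : A) : (a * x - x * a) * (a * y - y * a) ∈ I := by
    refine (I.smul_mem_iff h2).1 ?_
    have h : (2 : F) • ((a * x - x * a) * (a * y - y * a)) =
        (a * (a * (x * y) - x * y * a) - (a * (x * y) - x * y * a) * a)
          - (a * (a * x - x * a) - (a * x - x * a) * a) * y
          - x * (a * (a * y - y * a) - (a * y - y * a) * a) := by
      rw [two_smul]
      simp only [mul_sub, sub_mul, mul_assoc]
      abel
    rw [h]
    exact I.sub_mem (I.sub_mem (ha _) (hI y _ (ha x)).2) (hI x _ (ha y)).1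
  intro x
  refine hsp _ fun y => ?_
  have h : (a * x - x * a) * y * (a * x - x * a) =
      (a * x - x * a) * (a * (y * x) - y * x * a) -
        (a * x - x * a) * (a * y - y * a) * x := by
    simp only [mul_sub, sub_mul, mul_assoc]
    abel
  rw [h]
  exact I.sub_mem (hdd _ _) (hI x _ (hdd _ _)).2

omit [SMulCommClass F A A] [IsScalarTower F A A] in
theorem isCentralMod_of_ad_ad_isCentralMod {I : Submodule F A} (hI : IsTwoSidedIdeal I)
    (hsp : IsSemiprimeSubmodule I) (h2 : (2 : F) ≠ 0) {a : A}
    (ha : ∀ x : A, IsCentralMod I (a * (a * x - x * a) - (a * x - x * a) * a)) :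
    IsCentralMod I a := by
  refine isCentralMod_of_ad_ad_mem hI hsp h2 fun x => ?_
  have hz := ha x
  have hsq (r : A) :
      (a * r - r * a) * (a * (a * x - x * a) - (a * x - x * a) * a) ∈ I := by
    have h := I.sub_mem (ha (a * x) r) (hI a _ (hz r)).1
    convert h using 1
    simp only [mul_sub, sub_mul, mul_assoc]
    abel
  have hzz := hsq (a * x - x * a)
  generalize a * (a * x - x * a) - (a * x - x * a) * a = z at hz hzz ⊢
  refine hsp z fun y => ?_
  have h : z * y * z = z * z * y - z * (z * y - y * z) := by
    simp only [mul_sub, mul_assoc]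
    abel
  rw [h]
  exact I.sub_mem (hI y _ hzz).2 (hI z _ (hz y)).1

theorem commutator_mem_derivedPower (i : ℕ) (r : A) {u : A} (hu : u ∈ derivedPower F A i) :
    u * r - r * u ∈ derivedPower F A i := by
  induction i generalizing u with
  | zero => exact Submodule.mem_top
  | succ i ih =>
    have h : derivedPower F A (i + 1) ≤ (derivedPower F A (i + 1)).comap
        (LinearMap.mulRight F r - LinearMap.mulLeft F r) := by
      refine Submodule.span_le.2 ?_
      rintro _ ⟨v, hv, w, hw, rfl⟩
      have h1 : (v * r - r * v) * w - w * (v * r - r * v) ∈ derivedPower F A (i + 1) :=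
        Submodule.subset_span ⟨_, ih hv, _, hw, rfl⟩
      have h2 : v * (w * r - r * w) - (w * r - r * w) * v ∈ derivedPower F A (i + 1) :=
        Submodule.subset_span ⟨_, hv, _, ih hw, rfl⟩
      have h3 := add_mem h1 h2
      simp only [SetLike.mem_coe, Submodule.mem_comap, LinearMap.sub_apply,
        LinearMap.mulRight_apply, LinearMap.mulLeft_apply]
      convert h3 using 1
      simp only [mul_sub, sub_mul, mul_assoc]
      abel
    exact h hu

/-- Modulo a semiprime ideal, a Lie solvable algebra of characteristic not two is commutative. -/
theorem isCentralMod_of_derivedPower_le {I : Submodule F A} (hI : IsTwoSidedIdeal I)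
    (hsp : IsSemiprimeSubmodule I) (h2 : (2 : F) ≠ 0) (k : ℕ) (hk : derivedPower F A k ≤ I)
    (a : A) : IsCentralMod I a := by
  have key (k : ℕ) (h : ∀ u ∈ derivedPower F A k, IsCentralMod I u) (a : A) :
      IsCentralMod I a := by
    induction k with
    | zero => exact h a Submodule.mem_top
    | succ k ih =>
      refine ih fun u hu => isCentralMod_of_ad_ad_isCentralMod hI hsp h2 fun x => ?_
      refine h _ (Submodule.subset_span ⟨u, hu, _, ?_, rfl⟩)
      exact commutator_mem_derivedPower k x hu
  exact key k (fun u hu r => I.sub_mem (hI r u (hk hu)).2 (hI r u (hk hu)).1) a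

omit [SMulCommClass F A A] [IsScalarTower F A A] in
theorem mem_of_nuPow_mem {I : Submodule F A} (hI : IsTwoSidedIdeal I)
    (hsp : IsSemiprimeSubmodule I) (hcomm : ∀ a : A, IsCentralMod I a) {a : A} (m : ℕ)
    (hm : nuPow a m ∈ I) : a ∈ I := by
  induction m with
  | zero => exact hm
  | succ m ih =>
    refine ih (hsp _ fun x => ?_)
    have hba : nuPow a m * a ∈ I := by
      have h := I.sub_mem hm (hcomm a (nuPow a m))
      rwa [nuPow, sub_sub_cancel] at h
    have hbxa : nuPow a m * (x * a) ∈ I := by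
      have h := I.sub_mem (hI x _ hba).2 (hI (nuPow a m) _ (hcomm a x)).1
      rwa [mul_sub, mul_assoc, sub_sub_cancel] at h
    rw [mul_assoc]
    cases m with
    | zero => exact hbxa
    | succ m =>
      have h := (hI (nuPow a m) _ hbxa).2
      rwa [mul_assoc, mul_assoc x] at h

/-- An ideal maximal among those containing no power of the algebra is semiprime. -/
theorem isSemiprimeSubmodule_of_maximal {I : Submodule F A} (hI : IsTwoSidedIdeal I)
    (hpow : ∀ n, ¬ subPow F (⊤ : Submodule F A) n ≤ I)
    (hmax : ∀ J : Submodule F A, IsTwoSidedIdeal J → I ≤ J →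
      (∀ n, ¬ subPow F (⊤ : Submodule F A) n ≤ J) → J ≤ I) : IsSemiprimeSubmodule I := by
  intro a ha
  by_contra haI
  let J : Submodule F A := algIdealGen F (insert a (I : Set A))
  have hJ : IsTwoSidedIdeal J := isTwoSidedIdeal_algIdealGen _
  have hIJ : I ≤ J := fun x hx => subset_algIdealGen _ (Set.mem_insert_of_mem _ hx)
  have haJ : a ∈ J := subset_algIdealGen _ (Set.mem_insert _ _)
  have hn : ∃ n, subPow F (⊤ : Submodule F A) n ≤ J := by
    by_contra! hn
    exact haI (hmax J hJ hIJ hn haJ)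
  obtain ⟨n, hn⟩ := hn
  let P : Submodule F A :=
    { carrier := {y | ∀ x, y * x * a ∈ I}
      add_mem' := fun {y z} hy hz x => by
        rw [add_mul, add_mul]; exact I.add_mem (hy x) (hz x)
      zero_mem' := fun x => by rw [zero_mul, zero_mul]; exact I.zero_mem
      smul_mem' := fun c y hy x => by
        rw [smul_mul_assoc, smul_mul_assoc]; exact I.smul_mem c (hy x) }
  have hJP : J ≤ P := by
    refine algIdealGen_le ?_ fun r y hy => ⟨fun x => ?_, fun x => ?_⟩
    · rintro y (rfl | hy) x
      · exact ha x
      · exact (hI a _ (hI x y hy).2).2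
    · rw [mul_assoc r, mul_assoc r]
      exact (hI r _ (hy x)).1
    · rw [mul_assoc y]
      exact hy _
  let Q : Submodule F A :=
    { carrier := {y | ∀ z ∈ J, ∀ x, z * x * y ∈ I}
      add_mem' := fun {y w} hy hw z hz x => by
        rw [mul_add]; exact I.add_mem (hy z hz x) (hw z hz x)
      zero_mem' := fun z _ x => by rw [mul_zero]; exact I.zero_mem
      smul_mem' := fun c y hy z hz x => by
        rw [mul_smul_comm]; exact I.smul_mem c (hy z hz x) }
  have hJQ : J ≤ Q := by
    refine algIdealGen_le ?_ fun r y hy => ⟨fun z hz x => ?_, fun z hz x => ?_⟩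
    · rintro y (rfl | hy) z hz x
      · exact hJP hz x
      · exact (hI _ y hy).1
    · rw [← mul_assoc, mul_assoc z]
      exact hy z hz _
    · rw [← mul_assoc]
      exact (hI r _ (hy z hz x)).2
  refine hpow (n + (n + 1) + 1) ((subPow_add_le _ _ _).trans (mulSpan_le.2 fun u hu v hv => ?_))
  have h : subPow F (⊤ : Submodule F A) (n + 1) ≤ I.comap (LinearMap.mulLeft F u) := by
    refine mulSpan_le.2 fun x _ w hw => ?_
    rw [Submodule.mem_comap, LinearMap.mulLeft_apply, ← mul_assoc]
    exact hJQ (hn hw) u (hn hu) x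
  exact h hv

omit [SMulCommClass F A A] [IsScalarTower F A A] in
theorem isTwoSidedIdeal_sSup_of_isChain {c : Set (Submodule F A)} (hne : c.Nonempty)
    (hc : IsChain (· ≤ ·) c) (h : ∀ I ∈ c, IsTwoSidedIdeal I) : IsTwoSidedIdeal (sSup c) := by
  intro a x hx
  obtain ⟨I, hIc, hxI⟩ := (Submodule.mem_sSup_of_directed hne hc.directedOn).1 hx
  exact ⟨le_sSup hIc (h I hIc a x hxI).1, le_sSup hIc (h I hIc a x hxI).2⟩

/-- In a finitely generated algebra, an ideal containing no power of the algebra is contained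
in a semiprime ideal containing no power of the algebra. -/
theorem exists_le_isSemiprimeSubmodule (S : Finset A) (hgen : algClosure F (S : Set A) = ⊤)
    {G : Submodule F A} (hG : IsTwoSidedIdeal G)
    (hpow : ∀ n, ¬ subPow F (⊤ : Submodule F A) n ≤ G) :
    ∃ I : Submodule F A, G ≤ I ∧ IsTwoSidedIdeal I ∧ IsSemiprimeSubmodule I ∧
      ∀ n, ¬ subPow F (⊤ : Submodule F A) n ≤ I := by
  obtain ⟨I, hGI, hI⟩ := zorn_le_nonempty₀
    {I : Submodule F A | IsTwoSidedIdeal I ∧ ∀ n, ¬ subPow F (⊤ : Submodule F A) n ≤ I}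
    (fun c hcs hc J hJ => by
      refine ⟨sSup c, ⟨isTwoSidedIdeal_sSup_of_isChain ⟨J, hJ⟩ hc fun I hI => (hcs hI).1,
        fun n hn => ?_⟩, fun _ => le_sSup⟩
      obtain ⟨T, hT, hTK⟩ := exists_finset_subPow_top_le S hgen n
      have hTc : (T : Set A) ⊆ ⋃ I ∈ c, (I : Set A) := fun t ht => by
        obtain ⟨I, hIc, htI⟩ :=
          (Submodule.mem_sSup_of_directed ⟨J, hJ⟩ hc.directedOn).1 (hn (hT ht))
        exact Set.mem_biUnion hIc htI
      obtain ⟨I, hIc, hTI⟩ := DirectedOn.exists_mem_subset_of_finset_subset_biUnion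
        (f := fun I : Submodule F A => (I : Set A)) ⟨J, hJ⟩ hc.directedOn hTc
      exact (hcs hIc).2 n (hTK I (fun x hx a => ((hcs hIc).1 a x hx).2) hTI)) G ⟨hG, hpow⟩
  exact ⟨I, hGI, hI.prop.1, isSemiprimeSubmodule_of_maximal hI.prop.1 hI.prop.2
    fun J hJ hIJ hJpow => hI.le_of_ge ⟨hJ, hJpow⟩ hIJ, hI.prop.2⟩

end Helpers

/-- Let `A` be an associative algebra over a field of characteristic `≠ 2`
generated by a finite collection of nilpotent elements.  Then for every `k ≥ 1` the quotient
`A / id_A(A^{[k]})` is nilpotent; equivalently, some power `Aⁿ` (`n ≥ 1`) is contained in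
the two-sided ideal `id_A(A^{[k]})`.  (Here `Aⁿ = subPow F ⊤ (n-1)`.) -/
theorem quotient_by_idealGen_derivedPower_nilpotent
    (F : Type*) [Field F] (hchar : ringChar F ≠ 2)
    (A : Type*) [NonUnitalRing A] [Module F A] [SMulCommClass F A A] [IsScalarTower F A A]
    (S : Finset A) (hnil : ∀ a ∈ S, ∃ m : ℕ, nuPow a m = 0)
    (hgen : algClosure F (↑S : Set A) = ⊤)
    (k : ℕ) (hk : 1 ≤ k) :
    ∃ n : ℕ, subPow F (⊤ : Submodule F A) n ≤ algIdealGen F (derivedPower F A k : Set A) := by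
  by_contra! hpow
  obtain ⟨I, hGI, hI, hsp, hIpow⟩ :=
    exists_le_isSemiprimeSubmodule S hgen (isTwoSidedIdeal_algIdealGen _) hpow
  have hcomm := isCentralMod_of_derivedPower_le hI hsp (Ring.two_ne_zero hchar) k
    fun x hx => hGI (subset_algIdealGen _ hx)
  refine hIpow 0 ?_
  rw [subPow, ← hgen]
  refine algClosure_le (fun a ha => ?_) fun x _ y hy => (hI x y hy).1
  obtain ⟨m, hm⟩ := hnil a ha
  exact mem_of_nuPow_mem hI hsp hcomm m (hm ▸ I.zero_mem)
end
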